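/- Let H ≤ F be a subgroup. Define the small horospheric limit set Λ^horS = { ω ∈ ∂F : for every N ∈ ℤ the set {h ∈ H : b_ω(h) ≤ N} is infinite }, the big horospheric limit set Λ^horB = { ω ∈ ∂F : there exists N ∈ ℤ such that {h ∈ H : b_ω(h) ≤ N} is infinite }, and Σ = { ω ∈ ∂F : Σ_{h∈H} (2m−1)^{−b_ω(h)} = ∞ }. Then Λ^horS ⊆ Λ^horB ⊆ Σ and μ(Σ \ Λ^horS) = 0; in particular the three sets Λ^horS, Λ^horB and Σ coincide up to μ-null sets. -/

import Mathlib

open MeasureTheory Filter Topology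
open scoped ENNReal symmDiff

noncomputable section

/-- A letter of the alphabet `A ∪ A⁻¹` for the free group on `Fin m`. -/
abbrev Letter (m : ℕ) := Fin m × Bool

/-- The inverse letter. -/
def linv {m : ℕ} (x : Letter m) : Letter m := (x.1, !x.2)

/-- A sequence of letters is reduced if no letter is followed by its inverse. -/
def IsRedSeq {m : ℕ} (ω : ℕ → Letter m) : Prop := ∀ n, ω (n + 1) ≠ linv (ω n)

/-- The boundary `∂F`: infinite reduced words. -/
abbrev Boundary (m : ℕ) := {ω : ℕ → Letter m // IsRedSeq ω}

/-- Word length of an element of the free group. -/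
def wlen {m : ℕ} (g : FreeGroup (Fin m)) : ℕ := g.toWord.length

/-- The truncation `[ω]ₙ`: the group element given by the first `n` letters of `ω`. -/
def trunc {m : ℕ} (ω : Boundary m) (n : ℕ) : FreeGroup (Fin m) :=
  FreeGroup.mk (List.ofFn fun i : Fin n => ω.1 i)

/-- Cylinder set `C_g`. -/
def cylinder {m : ℕ} (g : FreeGroup (Fin m)) : Set (Boundary m) :=
  {ω | trunc ω (wlen g) = g}

/-- The Gromov product `(g|ω)`: length of the longest common initial segment of the
reduced word of `g` and `ω`. -/
def gromov {m : ℕ} (g : FreeGroup (Fin m)) (ω : Boundary m) : ℕ :=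
  sSup {k | ∀ i < k, g.toWord[i]? = some (ω.1 i)}

/-- The Busemann function `b_ω(g) = |g| - 2 (g|ω)`. -/
def busemann {m : ℕ} (g : FreeGroup (Fin m)) (ω : Boundary m) : ℤ :=
  (wlen g : ℤ) - 2 * (gromov g ω : ℤ)

/-- The number of letters cancelled in the free reduction of the concatenation
of a finite word `w` with an infinite reduced word `ω`. -/
def cancelLen {m : ℕ} (w : List (Letter m)) (ω : ℕ → Letter m) : ℕ :=
  sSup {k | k ≤ w.length ∧ ∀ i < k, w[w.length - 1 - i]? = some (linv (ω i))}

/-- The sequence of letters of the free reduction of (reduced word of `g`) ++ `ω`. -/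
def actSeq {m : ℕ} (g : FreeGroup (Fin m)) (ω : Boundary m) (n : ℕ) : Letter m :=
  if h : n < g.toWord.length - cancelLen g.toWord ω.1
  then g.toWord[n]'(by omega)
  else ω.1 (n - (g.toWord.length - cancelLen g.toWord ω.1) + cancelLen g.toWord ω.1)

theorem linv_linv {m : ℕ} (x : Letter m) : linv (linv x) = x := by
  simp [linv]

theorem toWord_chain {m : ℕ} (g : FreeGroup (Fin m)) {j : ℕ} (hj : j + 1 < g.toWord.length) :
    g.toWord[j + 1]'hj ≠ linv (g.toWord[j]'(by omega)) := by
  intro h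
  have hsplit : g.toWord = g.toWord.take j ++
      (g.toWord[j]'(by omega)) :: (g.toWord[j+1]'hj) :: g.toWord.drop (j + 2) := by
    conv_lhs => rw [← List.take_append_drop j g.toWord]
    congr 1
    rw [List.drop_eq_getElem_cons (by omega)]
    congr 1
    rw [List.drop_eq_getElem_cons (by omega)]
  rw [h] at hsplit
  have hred : FreeGroup.reduce g.toWord = g.toWord := FreeGroup.reduce_toWord g
  exact FreeGroup.reduce.not (by rw [hred, hsplit]; rfl)

theorem cancelLen_spec {m : ℕ} (w : List (Letter m)) (ω : ℕ → Letter m) :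
    cancelLen w ω ≤ w.length ∧
      ∀ i < cancelLen w ω, w[w.length - 1 - i]? = some (linv (ω i)) := by
  have : cancelLen w ω ∈
      {k | k ≤ w.length ∧ ∀ i < k, w[w.length - 1 - i]? = some (linv (ω i))} := by
    apply Nat.sSup_mem ⟨0, by simp⟩ ⟨w.length, fun x hx => hx.1⟩
  exact this

theorem cancelLen_max {m : ℕ} (w : List (Letter m)) (ω : ℕ → Letter m)
    (hlt : cancelLen w ω < w.length) :
    w[w.length - 1 - cancelLen w ω]? ≠ some (linv (ω (cancelLen w ω))) := by
  intro hcon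
  have hmem : cancelLen w ω + 1 ∈
      {k | k ≤ w.length ∧ ∀ i < k, w[w.length - 1 - i]? = some (linv (ω i))} := by
    refine ⟨hlt, fun i hi => ?_⟩
    rcases Nat.lt_succ_iff_lt_or_eq.mp hi with h | h
    · exact (cancelLen_spec w ω).2 i h
    · subst h; exact hcon
  have := le_csSup ⟨w.length, fun x hx => hx.1⟩ hmem
  simp only [cancelLen] at this ⊢
  omega

theorem isRedSeq_actSeq {m : ℕ} (g : FreeGroup (Fin m)) (ω : Boundary m) :
    IsRedSeq (actSeq g ω) := by
  intro n
  obtain ⟨hkle, hcan⟩ := cancelLen_spec g.toWord ω.1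
  by_cases h1 : n + 1 < g.toWord.length - cancelLen g.toWord ω.1
  · have h0 : n < g.toWord.length - cancelLen g.toWord ω.1 := by omega
    rw [show actSeq g ω (n + 1) = g.toWord[n + 1]'(by omega) from dif_pos h1,
        show actSeq g ω n = g.toWord[n]'(by omega) from dif_pos h0]
    exact toWord_chain g (by omega)
  · by_cases h0 : n < g.toWord.length - cancelLen g.toWord ω.1
    · have hklt : cancelLen g.toWord ω.1 < g.toWord.length := by omega
      have hidx : n = g.toWord.length - 1 - cancelLen g.toWord ω.1 := by omega
      have e0 : actSeq g ω n = g.toWord[n]'(by omega) := dif_pos h0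
      have e1 : actSeq g ω (n + 1) =
          ω.1 (n + 1 - (g.toWord.length - cancelLen g.toWord ω.1) +
            cancelLen g.toWord ω.1) := dif_neg h1
      have harg : n + 1 - (g.toWord.length - cancelLen g.toWord ω.1) +
          cancelLen g.toWord ω.1 = cancelLen g.toWord ω.1 := by omega
      rw [harg] at e1
      rw [e0, e1]
      intro hcon
      apply cancelLen_max g.toWord ω.1 hklt
      subst hidx
      rw [List.getElem?_eq_getElem (by omega), hcon, linv_linv]
    · have e0 : actSeq g ω n =
          ω.1 (n - (g.toWord.length - cancelLen g.toWord ω.1) +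
            cancelLen g.toWord ω.1) := dif_neg h0
      have e1 : actSeq g ω (n + 1) =
          ω.1 (n + 1 - (g.toWord.length - cancelLen g.toWord ω.1) +
            cancelLen g.toWord ω.1) := dif_neg (by omega)
      have harg : n + 1 - (g.toWord.length - cancelLen g.toWord ω.1) +
          cancelLen g.toWord ω.1 =
          (n - (g.toWord.length - cancelLen g.toWord ω.1) + cancelLen g.toWord ω.1) + 1 := by
        omega
      rw [e0, e1, harg]
      exact ω.2 _

/-- The boundary action of `F` on `∂F`: `g · ω` is the free reduction of the
concatenation of the reduced word of `g` with `ω`. -/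
def bact {m : ℕ} (g : FreeGroup (Fin m)) (ω : Boundary m) : Boundary m :=
  ⟨actSeq g ω, isRedSeq_actSeq g ω⟩


variable {m : ℕ}

/-- The length of the longest common initial segment of a finite and an infinite word. -/
def commonPrefix : List (Letter m) → (ℕ → Letter m) → ℕ
  | [], _ => 0
  | a :: L, s => if a = s 0 then commonPrefix L (fun n => s (n + 1)) + 1 else 0

theorem le_commonPrefix_iff (L : List (Letter m)) (s : ℕ → Letter m) (k : ℕ) :
    k ≤ commonPrefix L s ↔ ∀ i < k, L[i]? = some (s i) := by
  induction L generalizing s k with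
  | nil =>
    simp only [commonPrefix, nonpos_iff_eq_zero, List.getElem?_nil, reduceCtorEq, imp_false, not_lt]
    exact ⟨fun h _ => h ▸ Nat.zero_le _, fun h => Nat.le_zero.mp (h 0)⟩
  | cons a L ih =>
    cases k with
    | zero => simp
    | succ k =>
      rw [Nat.forall_lt_succ_left]
      by_cases h : a = s 0
      · simp [commonPrefix, h, ih]
      · simp [commonPrefix, h]

theorem gromov_eq_commonPrefix (g : FreeGroup (Fin m)) (ω : Boundary m) :
    gromov g ω = commonPrefix g.toWord ω.1 := by
  have : {k | ∀ i < k, g.toWord[i]? = some (ω.1 i)} = Set.Iic (commonPrefix g.toWord ω.1) := by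
    ext k
    simp [le_commonPrefix_iff]
  rw [gromov, this, csSup_Iic]

theorem le_gromov_iff (g : FreeGroup (Fin m)) (ω : Boundary m) (k : ℕ) :
    k ≤ gromov g ω ↔ ∀ i < k, g.toWord[i]? = some (ω.1 i) := by
  rw [gromov_eq_commonPrefix, le_commonPrefix_iff]

theorem gromov_le_wlen (g : FreeGroup (Fin m)) (ω : Boundary m) : gromov g ω ≤ wlen g := by
  by_contra! h
  have := (le_gromov_iff g ω _).1 h (wlen g) (Nat.lt_succ_self _)
  simp [wlen] at this

theorem toWord_mk_of_isReduced {L : List (Letter m)} (h : FreeGroup.IsReduced L) :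
    (FreeGroup.mk L).toWord = L := by
  rw [FreeGroup.toWord_mk, h.reduce_eq]

theorem toWord_trunc (ω : Boundary m) (n : ℕ) :
    (trunc ω n).toWord = List.ofFn fun i : Fin n => ω.1 i := by
  refine toWord_mk_of_isReduced (List.isChain_ofFn.2 fun i hi h1 => ?_)
  by_contra h2
  refine ω.2 i (Prod.ext h1.symm ?_)
  cases h3 : (ω.1 i).2 <;> cases h4 : (ω.1 (i + 1)).2 <;> simp_all [linv]

theorem wlen_trunc (ω : Boundary m) (n : ℕ) : wlen (trunc ω n) = n := by
  simp [wlen, toWord_trunc]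

theorem mem_cylinder_iff (g : FreeGroup (Fin m)) (ω : Boundary m) :
    ω ∈ cylinder g ↔ wlen g ≤ gromov g ω := by
  change trunc ω (wlen g) = g ↔ _
  rw [le_gromov_iff, ← FreeGroup.toWord_inj, toWord_trunc, List.ext_getElem?_iff]
  refine forall_congr' fun i => ?_
  by_cases hi : i < wlen g
  · simp [hi, eq_comm]
  · have : g.toWord.length ≤ i := by simpa [wlen] using hi
    simp [hi, List.getElem?_eq_none this]

theorem mem_cylinder_iff_commonPrefix (g : FreeGroup (Fin m)) (ω : Boundary m) :
    ω ∈ cylinder g ↔ g.toWord.length ≤ commonPrefix g.toWord ω.1 := by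
  rw [mem_cylinder_iff, gromov_eq_commonPrefix, wlen]

theorem mem_cylinder_trunc (ω : Boundary m) (n : ℕ) : ω ∈ cylinder (trunc ω n) := by
  change trunc ω (wlen (trunc ω n)) = trunc ω n
  rw [wlen_trunc]

theorem eq_trunc_of_mem_cylinder {g : FreeGroup (Fin m)} {ω : Boundary m} (h : ω ∈ cylinder g) :
    g = trunc ω (wlen g) := h.symm

theorem wlen_ne_zero_iff {g : FreeGroup (Fin m)} : wlen g ≠ 0 ↔ g ≠ 1 := by
  simp [wlen]

/-- The initial segment of length `k` of the reduced word of `g`. -/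
def initial (g : FreeGroup (Fin m)) (k : ℕ) : FreeGroup (Fin m) :=
  FreeGroup.mk (g.toWord.take k)

theorem toWord_initial (g : FreeGroup (Fin m)) (k : ℕ) :
    (initial g k).toWord = g.toWord.take k :=
  toWord_mk_of_isReduced (FreeGroup.isReduced_toWord.infix (List.take_prefix _ _).isInfix)

theorem wlen_initial {g : FreeGroup (Fin m)} {k : ℕ} (hk : k ≤ wlen g) :
    wlen (initial g k) = k := by
  rw [wlen, toWord_initial, List.length_take]
  exact min_eq_left hk

theorem mem_cylinder_initial_iff {g : FreeGroup (Fin m)} {k : ℕ} (hk : k ≤ wlen g)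
    (ω : Boundary m) : ω ∈ cylinder (initial g k) ↔ k ≤ gromov g ω := by
  rw [mem_cylinder_iff, wlen_initial hk, le_gromov_iff, le_gromov_iff, toWord_initial]
  refine forall₂_congr fun i hi => ?_
  rw [List.getElem?_take_of_lt hi]

theorem cylinder_subset_of_mem {g g' : FreeGroup (Fin m)} (hle : wlen g ≤ wlen g')
    {ω : Boundary m} (h : ω ∈ cylinder g) (h' : ω ∈ cylinder g') : cylinder g' ⊆ cylinder g := by
  intro η hη
  rw [mem_cylinder_iff, le_gromov_iff] at *
  intro i hi
  rw [h i hi, ← h' i (hi.trans_le hle), hη i (hi.trans_le hle)]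

/-- The boundary point obtained by deleting the first letter. -/
def Boundary.tail (ω : Boundary m) : Boundary m := ⟨fun n => ω.1 (n + 1), fun n => ω.2 (n + 1)⟩

/-- The boundary point obtained by prepending a letter. -/
def Boundary.cons (x : Letter m) (ω : Boundary m) (h : ω.1 0 ≠ linv x) : Boundary m :=
  ⟨fun n => Nat.casesOn n x ω.1, fun n => by
    cases n with
    | zero => exact h
    | succ n => exact ω.2 n⟩

theorem Boundary.cons_zero (x : Letter m) (ω : Boundary m) (h : ω.1 0 ≠ linv x) :
    (ω.cons x h).1 0 = x := rfl

/-- The action of a letter on the boundary. -/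
def letterAct (x : Letter m) (ω : Boundary m) : Boundary m :=
  if h : ω.1 0 = linv x then ω.tail else ω.cons x h

theorem letterAct_linv_letterAct (x : Letter m) (ω : Boundary m) :
    letterAct (linv x) (letterAct x ω) = ω := by
  by_cases h : ω.1 0 = linv x
  · have h' : ω.tail.1 0 ≠ linv (linv x) := by rw [← h]; exact ω.2 0
    rw [letterAct, letterAct, dif_pos h, dif_neg h']
    refine Subtype.ext (funext fun n => ?_)
    cases n with
    | zero => exact h.symm
    | succ n => rfl
  · rw [letterAct, letterAct, dif_neg h,
      dif_pos ((ω.cons_zero x h).trans (linv_linv x).symm)]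
    rfl

/-- The action of a letter on the boundary, as a permutation. -/
def letterPerm (x : Letter m) : Equiv.Perm (Boundary m) where
  toFun := letterAct x
  invFun := letterAct (linv x)
  left_inv := letterAct_linv_letterAct x
  right_inv ω := by simpa only [linv_linv] using letterAct_linv_letterAct (linv x) ω

/-- The action of the free group on its boundary, as a homomorphism into permutations. -/
def boundaryAction (m : ℕ) : FreeGroup (Fin m) →* Equiv.Perm (Boundary m) :=
  FreeGroup.lift fun i => letterPerm (i, true)

/-- A letter, as an element of the free group. -/
def ofLetter (x : Letter m) : FreeGroup (Fin m) := FreeGroup.mk [x]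

theorem ofLetter_inv (x : Letter m) : (ofLetter x)⁻¹ = ofLetter (linv x) := by
  simp [ofLetter, linv, FreeGroup.invRev]

theorem boundaryAction_ofLetter (x : Letter m) (ω : Boundary m) :
    boundaryAction m (ofLetter x) ω = letterAct x ω := by
  obtain ⟨i, b⟩ := x
  have h : boundaryAction m (ofLetter (i, true)) = letterPerm (i, true) :=
    FreeGroup.lift_apply_of
  cases b
  · have : ofLetter (i, false) = (ofLetter (i, true))⁻¹ := by rw [ofLetter_inv]; rfl
    rw [this, map_inv, h]
    rfl
  · rw [h]
    rfl

/-- A property closed under multiplication that holds for all letters and the identity holds for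
all elements of the free group. -/
theorem freeGroup_induction {p : FreeGroup (Fin m) → Prop} (one : p 1)
    (letter : ∀ x : Letter m, p (ofLetter x)) (mul : ∀ g h, p g → p h → p (g * h))
    (g : FreeGroup (Fin m)) : p g :=
  FreeGroup.induction_on g one (fun i => letter (i, true))
    (fun i _ => letter (i, false)) (fun g h => mul g h)

theorem toWord_ofLetter_mul_of_head {x : Letter m} {g : FreeGroup (Fin m)} {t : List (Letter m)}
    (h : g.toWord = linv x :: t) : (ofLetter x * g).toWord = t := by
  have hx : (ofLetter x).toWord = [x] := rfl
  have hr := FreeGroup.reduce_toWord g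
  rw [FreeGroup.toWord_mul, hx, List.singleton_append, FreeGroup.reduce.cons, hr, h]
  simp [linv]

theorem toWord_ofLetter_mul_of_ne_head {x : Letter m} {g : FreeGroup (Fin m)}
    (h : ∀ t, g.toWord ≠ linv x :: t) : (ofLetter x * g).toWord = x :: g.toWord := by
  have hx : (ofLetter x).toWord = [x] := rfl
  have hr := FreeGroup.reduce_toWord g
  rw [FreeGroup.toWord_mul, hx, List.singleton_append, FreeGroup.reduce.cons, hr]
  rcases hg : g.toWord with _ | ⟨y, t⟩
  · rfl
  · have : ¬ (x.1 = y.1 ∧ x.2 = !y.2) := by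
      rintro ⟨h1, h2⟩
      exact h t (by rw [hg, linv, h1, h2]; simp)
    simp [this]

theorem busemann_eq (g : FreeGroup (Fin m)) (ω : Boundary m) :
    busemann g ω = g.toWord.length - 2 * commonPrefix g.toWord ω.1 := by
  rw [busemann, gromov_eq_commonPrefix, wlen]

theorem busemann_one (ω : Boundary m) : busemann 1 ω = 0 := by
  simp [busemann_eq, commonPrefix]

theorem commonPrefix_eq_zero_of_toWord_eq_cons {g : FreeGroup (Fin m)} {x : Letter m}
    {t : List (Letter m)} (h : g.toWord = linv x :: t) {s : ℕ → Letter m} (hs : s 0 = x) :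
    commonPrefix t s = 0 := by
  rcases t with _ | ⟨y, t⟩
  · rfl
  · rw [commonPrefix, if_neg]
    rintro rfl
    have := toWord_chain g (j := 0) (by simp [h])
    simp [h, hs, linv_linv] at this

theorem busemann_ofLetter (x : Letter m) (ω : Boundary m) :
    busemann (ofLetter x) ω = if ω.1 0 = x then -1 else 1 := by
  have hx : (ofLetter x).toWord = [x] := rfl
  rw [busemann_eq, hx]
  by_cases h : ω.1 0 = x
  · simp [commonPrefix, h]
  · simp [commonPrefix, h, Ne.symm h]

theorem busemann_ofLetter_mul (x : Letter m) (g : FreeGroup (Fin m)) (ω : Boundary m) :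
    busemann (ofLetter x * g) ω = busemann (ofLetter x) ω + busemann g (letterAct (linv x) ω) := by
  rw [busemann_ofLetter, busemann_eq, busemann_eq, letterAct]
  have htail : (fun n => ω.1 (n + 1)) = ω.tail.1 := rfl
  by_cases hω : ω.1 0 = x
  · rw [if_pos hω, dif_pos (by rw [linv_linv, hω])]
    by_cases hg : ∃ t, g.toWord = linv x :: t
    · obtain ⟨t, ht⟩ := hg
      have h0 : linv x ≠ ω.tail.1 0 := by rw [← hω]; exact (ω.2 0).symm
      rw [toWord_ofLetter_mul_of_head ht, commonPrefix_eq_zero_of_toWord_eq_cons ht hω, ht,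
        commonPrefix, if_neg h0]
      simp
    · push Not at hg
      rw [toWord_ofLetter_mul_of_ne_head hg, commonPrefix, if_pos hω.symm, htail]
      push_cast [List.length_cons]
      ring
  · rw [if_neg hω, dif_neg (by rwa [linv_linv])]
    by_cases hg : ∃ t, g.toWord = linv x :: t
    · obtain ⟨t, ht⟩ := hg
      have h0 : (fun n => (ω.cons (linv x) (by rwa [linv_linv])).1 (n + 1)) = ω.1 := rfl
      rw [toWord_ofLetter_mul_of_head ht, ht, commonPrefix,
        if_pos (Boundary.cons_zero _ _ _).symm, h0]
      push_cast [List.length_cons]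
      ring
    · push Not at hg
      have h0 : commonPrefix g.toWord (ω.cons (linv x) (by rwa [linv_linv])).1 = 0 := by
        rcases h : g.toWord with _ | ⟨y, t⟩
        · rfl
        · rw [commonPrefix, if_neg]
          rintro rfl
          exact hg t h
      rw [toWord_ofLetter_mul_of_ne_head hg, commonPrefix, if_neg (Ne.symm hω), h0]
      push_cast [List.length_cons]
      ring

/-- The cocycle identity for the Busemann function. -/
theorem busemann_mul (g h : FreeGroup (Fin m)) (ω : Boundary m) :
    busemann (g * h) ω = busemann g ω + busemann h (boundaryAction m g⁻¹ ω) := by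
  induction g using freeGroup_induction generalizing h ω with
  | one => simp [busemann_one]
  | letter x => rw [ofLetter_inv, boundaryAction_ofLetter, busemann_ofLetter_mul]
  | mul g₁ g₂ h₁ h₂ =>
    rw [mul_assoc, h₁, h₂, h₁ g₂, mul_inv_rev, map_mul, Equiv.Perm.mul_apply, add_assoc]

theorem boundaryAction_inv_apply_self (g : FreeGroup (Fin m)) (ω : Boundary m) :
    boundaryAction m g⁻¹ (boundaryAction m g ω) = ω := by
  rw [← Equiv.Perm.mul_apply, ← map_mul, inv_mul_cancel, map_one, Equiv.Perm.one_apply]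

theorem busemann_boundaryAction (g h : FreeGroup (Fin m)) (ω : Boundary m) :
    busemann h (boundaryAction m g ω) = busemann (g⁻¹ * h) ω - busemann g⁻¹ ω := by
  rw [busemann_mul, inv_inv, add_sub_cancel_left]

theorem measurable_commonPrefix (L : List (Letter m)) : Measurable (commonPrefix L) := by
  induction L with
  | nil => exact measurable_const
  | cons a L ih =>
    refine Measurable.ite ?_ ?_ measurable_const
    · exact measurableSet_eq_fun measurable_const (measurable_pi_apply 0)
    · exact (ih.comp (measurable_pi_lambda _ fun n => measurable_pi_apply (n + 1))).add_const 1

theorem measurable_gromov (g : FreeGroup (Fin m)) : Measurable (gromov g) := by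
  simp_rw [funext (gromov_eq_commonPrefix g)]
  exact (measurable_commonPrefix _).comp measurable_subtype_coe

theorem measurable_busemann (g : FreeGroup (Fin m)) : Measurable (busemann g) :=
  (measurable_from_top (f := fun k : ℕ => (wlen g : ℤ) - 2 * (k : ℤ))).comp (measurable_gromov g)

theorem measurableSet_cylinder (g : FreeGroup (Fin m)) : MeasurableSet (cylinder g) := by
  have : cylinder g = gromov g ⁻¹' Set.Ici (wlen g) := Set.ext (mem_cylinder_iff g)
  rw [this]
  exact measurable_gromov g measurableSet_Ici

theorem measurable_coord (n : ℕ) : Measurable fun ω : Boundary m => ω.1 n :=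
  (measurable_pi_apply n).comp measurable_subtype_coe

theorem measurable_letterAct (x : Letter m) : Measurable (letterAct x) := by
  refine Measurable.subtype_mk (f := fun ω => (letterAct x ω).1) (h := fun ω => (letterAct x ω).2)
    (measurable_pi_lambda _ fun n => ?_)
  have : (fun ω : Boundary m => (letterAct x ω).1 n) = fun ω =>
      if ω.1 0 = linv x then ω.1 (n + 1) else Nat.casesOn n x ω.1 := by
    funext ω
    unfold letterAct
    split_ifs <;> rfl
  rw [this]
  refine Measurable.ite (measurableSet_eq_fun (measurable_coord 0) measurable_const)
    (measurable_coord _) ?_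
  cases n with
  | zero => exact measurable_const
  | succ n => exact measurable_coord n

theorem measurable_boundaryAction (g : FreeGroup (Fin m)) : Measurable (boundaryAction m g) := by
  induction g using freeGroup_induction with
  | one => simpa using measurable_id
  | letter x => simpa only [funext (boundaryAction_ofLetter x)] using measurable_letterAct x
  | mul g₁ g₂ h₁ h₂ => rw [map_mul]; exact h₁.comp h₂

/-- The weight `(2m - 1)^{-b_ω(g)}`. -/
def weight (g : FreeGroup (Fin m)) (ω : Boundary m) : ℝ≥0∞ :=
  ((2 * m - 1 : ℕ) : ℝ≥0∞) ^ (-(busemann g ω))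

theorem measurable_weight (g : FreeGroup (Fin m)) : Measurable (weight g) :=
  (measurable_from_top (f := fun k : ℤ => ((2 * m - 1 : ℕ) : ℝ≥0∞) ^ (-k))).comp
    (measurable_busemann g)

theorem weight_one (ω : Boundary m) : weight 1 ω = 1 := by simp [weight, busemann_one]

theorem weight_mul (hm : 2 ≤ m) (g h : FreeGroup (Fin m)) (ω : Boundary m) :
    weight (g * h) ω = weight g ω * weight h (boundaryAction m g⁻¹ ω) := by
  have h0 : ((2 * m - 1 : ℕ) : ℝ≥0∞) ≠ 0 := by
    rw [Nat.cast_ne_zero]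
    omega
  rw [weight, busemann_mul, neg_add, ENNReal.zpow_add h0 (ENNReal.natCast_ne_top _), weight,
    weight]

theorem weight_ne_top (g : FreeGroup (Fin m)) (ω : Boundary m) (hm : 2 ≤ m) :
    weight g ω ≠ ⊤ := by
  have h0 : ((2 * m - 1 : ℕ) : ℝ≥0∞) ≠ 0 := by
    rw [Nat.cast_ne_zero]
    omega
  exact (ENNReal.zpow_lt_top h0 (ENNReal.natCast_ne_top _) _).ne

/-- The collection of cylinders of depth at least two. -/
def deepCylinders (m : ℕ) : Set (Set (Boundary m)) :=
  {s | ∃ g : FreeGroup (Fin m), 2 ≤ wlen g ∧ cylinder g = s}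

theorem isPiSystem_deepCylinders : IsPiSystem (deepCylinders m) := by
  rintro _ ⟨g, hg, rfl⟩ _ ⟨g', hg', rfl⟩ ⟨ω, h, h'⟩
  rcases le_total (wlen g) (wlen g') with hle | hle
  · exact ⟨g', hg', (Set.inter_eq_right.2 (cylinder_subset_of_mem hle h h')).symm⟩
  · exact ⟨g, hg, (Set.inter_eq_left.2 (cylinder_subset_of_mem hle h' h)).symm⟩

theorem generateFrom_deepCylinders :
    (inferInstance : MeasurableSpace (Boundary m)) =
      MeasurableSpace.generateFrom (deepCylinders m) := by
  apply le_antisymm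
  · have hcoord (n : ℕ) : Measurable[MeasurableSpace.generateFrom (deepCylinders m)]
        fun ω : Boundary m => ω.1 n := by
      refine @measurable_to_countable' _ _ _ _ (MeasurableSpace.generateFrom (deepCylinders m)) _
        fun a => ?_
      have : (fun ω : Boundary m => ω.1 n) ⁻¹' {a} =
          ⋃ g : {g : FreeGroup (Fin m) // wlen g = n + 2 ∧ g.toWord[n]? = some a},
            cylinder g.1 := by
        ext ω
        simp only [Set.mem_preimage, Set.mem_singleton_iff, Set.mem_iUnion, Subtype.exists,
          exists_prop]
        constructor
        · intro h
          refine ⟨trunc ω (n + 2), ⟨wlen_trunc _ _, ?_⟩, mem_cylinder_trunc _ _⟩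
          rw [toWord_trunc, List.getElem?_ofFn, dif_pos (by omega), h]
        · rintro ⟨g, ⟨hg, ha⟩, hω⟩
          rw [mem_cylinder_iff, le_gromov_iff] at hω
          have := hω n (by omega)
          rw [ha] at this
          exact (Option.some_injective _ this).symm
      rw [this]
      exact MeasurableSet.iUnion fun g => MeasurableSpace.measurableSet_generateFrom
        ⟨g.1, by have := g.2.1; omega, rfl⟩
    exact measurable_iff_comap_le.1
      (@measurable_pi_lambda _ _ _ (MeasurableSpace.generateFrom (deepCylinders m)) _ _ hcoord)
  · refine MeasurableSpace.generateFrom_le ?_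
    rintro _ ⟨g, -, rfl⟩
    exact measurableSet_cylinder g

/-- Two finite measures agreeing on all cylinders of depth at least two are equal. -/
theorem ext_of_cylinder {μ ν : Measure (Boundary m)} [IsFiniteMeasure μ]
    (h : ∀ g : FreeGroup (Fin m), 2 ≤ wlen g → μ (cylinder g) = ν (cylinder g)) : μ = ν := by
  refine Measure.ext_of_generateFrom_of_cover_subset generateFrom_deepCylinders
    isPiSystem_deepCylinders subset_rfl ?_ ?_ (fun _ _ => measure_ne_top μ _) ?_
  · exact (Set.countable_range (cylinder (m := m))).mono (by rintro _ ⟨g, -, rfl⟩; exact ⟨g, rfl⟩)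
  · refine Set.eq_univ_of_forall fun ω => ?_
    exact ⟨_, ⟨trunc ω 2, (wlen_trunc _ _).ge, rfl⟩, mem_cylinder_trunc _ _⟩
  · rintro _ ⟨g, hg, rfl⟩
    exact h g hg

/-- The defining property of the uniform measure on the boundary. -/
def IsUniform (μ : Measure (Boundary m)) : Prop :=
  ∀ g : FreeGroup (Fin m), g ≠ 1 →
    μ (cylinder g) = ((2 * m * (2 * m - 1) ^ (wlen g - 1) : ℕ) : ℝ≥0∞)⁻¹

theorem IsUniform.measure_cylinder_succ {μ : Measure (Boundary m)} (hμ : IsUniform μ) (hm : 2 ≤ m)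
    {g g' : FreeGroup (Fin m)} (hg : g ≠ 1) (h : wlen g' = wlen g + 1) :
    μ (cylinder g) = ((2 * m - 1 : ℕ) : ℝ≥0∞) * μ (cylinder g') := by
  have h0 : ((2 * m - 1 : ℕ) : ℝ≥0∞) ≠ 0 := by
    rw [Nat.cast_ne_zero]
    omega
  have hg1 := wlen_ne_zero_iff.2 hg
  have hg' : g' ≠ 1 := wlen_ne_zero_iff.1 (by omega)
  obtain ⟨k, hk⟩ := Nat.exists_eq_succ_of_ne_zero hg1
  rw [hμ g hg, hμ g' hg', h, hk, Nat.succ_eq_add_one, Nat.add_sub_cancel, Nat.add_sub_cancel,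
    pow_succ', mul_left_comm, Nat.cast_mul (2 * m - 1),
    ENNReal.mul_inv (.inl h0) (.inl (ENNReal.natCast_ne_top _)), ← mul_assoc,
    ENNReal.mul_inv_cancel h0 (ENNReal.natCast_ne_top _), one_mul]

theorem letterAct_preimage_cylinder (x : Letter m) {g : FreeGroup (Fin m)} (hg : 2 ≤ wlen g) :
    letterAct x ⁻¹' cylinder g = cylinder (ofLetter (linv x) * g) := by
  ext ω
  rw [Set.mem_preimage, mem_cylinder_iff_commonPrefix, mem_cylinder_iff_commonPrefix, letterAct]
  by_cases hx : ∃ t, g.toWord = x :: t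
  · obtain ⟨t, ht⟩ := hx
    rw [toWord_ofLetter_mul_of_head (t := t) (by rw [ht, linv_linv]), ht, commonPrefix]
    rw [wlen, ht] at hg
    rcases t with _ | ⟨y, t⟩
    · simp at hg
    have hy : y ≠ linv x := by
      have := toWord_chain g (j := 0) (by simp [ht])
      simpa [ht] using this
    split_ifs with h h1 h2
    · exact absurd h1 fun h1 => ω.2 0 (by rw [h, linv_linv]; exact h1.symm)
    · simp [commonPrefix, h, hy]
    · simp only [List.length_cons, add_le_add_iff_right]
      rfl
    · exact absurd (Boundary.cons_zero _ _ _).symm h2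
  · push Not at hx
    rw [toWord_ofLetter_mul_of_ne_head (by simpa only [linv_linv] using hx)]
    rw [commonPrefix]
    split_ifs with h h1 h2
    · simp only [List.length_cons, add_le_add_iff_right]
      rfl
    · exact absurd h.symm h1
    · exact absurd h2.symm h
    · rcases hw : g.toWord with _ | ⟨y, t⟩
      · simp [wlen, hw] at hg
      · have : y ≠ (ω.cons x h).1 0 := fun hy => hx t (by rw [hw, hy, Boundary.cons_zero])
        simp [commonPrefix, this]

theorem IsUniform.map_letterAct {μ : Measure (Boundary m)} [IsProbabilityMeasure μ]
    (hμ : IsUniform μ) (hm : 2 ≤ m) (x : Letter m) :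
    μ.map (letterAct x) = μ.withDensity (weight (ofLetter x)) := by
  have h0 : ((2 * m - 1 : ℕ) : ℝ≥0∞) ≠ 0 := by
    rw [Nat.cast_ne_zero]
    omega
  have : IsFiniteMeasure (μ.map (letterAct x)) := Measure.isFiniteMeasure_map _ _
  refine ext_of_cylinder fun g hg => ?_
  rw [Measure.map_apply (measurable_letterAct x) (measurableSet_cylinder g),
    letterAct_preimage_cylinder x hg, withDensity_apply _ (measurableSet_cylinder g)]
  have hg1 : g ≠ 1 := wlen_ne_zero_iff.1 (by omega)
  have hhead {ω : Boundary m} (hω : ω ∈ cylinder g) : g.toWord[0]? = some (ω.1 0) := by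
    rw [mem_cylinder_iff, le_gromov_iff] at hω
    exact hω 0 (by omega)
  by_cases hx : ∃ t, g.toWord = x :: t
  · obtain ⟨t, ht⟩ := hx
    have hlen : wlen g = wlen (ofLetter (linv x) * g) + 1 := by
      rw [wlen, wlen, toWord_ofLetter_mul_of_head (t := t) (by rw [ht, linv_linv]), ht,
        List.length_cons]
    rw [hμ.measure_cylinder_succ hm (wlen_ne_zero_iff.1 (by omega)) hlen,
      ← setLIntegral_const]
    refine setLIntegral_congr_fun (measurableSet_cylinder g) fun ω hω => ?_
    have : ω.1 0 = x := by simpa [ht, eq_comm] using hhead hω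
    simp [weight, busemann_ofLetter, this]
  · push Not at hx
    have hlen : wlen (ofLetter (linv x) * g) = wlen g + 1 := by
      rw [wlen, toWord_ofLetter_mul_of_ne_head (by simpa only [linv_linv] using hx), wlen,
        List.length_cons]
    have : ∫⁻ ω in cylinder g, weight (ofLetter x) ω ∂μ =
        ((2 * m - 1 : ℕ) : ℝ≥0∞)⁻¹ * μ (cylinder g) := by
      rw [← setLIntegral_const]
      refine setLIntegral_congr_fun (measurableSet_cylinder g) fun ω hω => ?_
      have : ω.1 0 ≠ x := by
        rintro rfl
        rcases hw : g.toWord with _ | ⟨y, t⟩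
        · simp [wlen, hw] at hg
        · have := hhead hω
          rw [hw] at this
          simp only [List.getElem?_cons_zero, Option.some.injEq] at this
          exact hx t (by rw [hw, this])
      rw [weight, busemann_ofLetter, if_neg this, ENNReal.zpow_neg, zpow_one]
    rw [this, hμ.measure_cylinder_succ hm hg1 hlen, ← mul_assoc,
      ENNReal.inv_mul_cancel h0 (ENNReal.natCast_ne_top _), one_mul]

/-- Change of variables: the Radon–Nikodym derivative of the translate of the uniform measure
under `g` is the weight of `g`. -/
theorem IsUniform.lintegral_boundaryAction {μ : Measure (Boundary m)} [IsProbabilityMeasure μ]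
    (hμ : IsUniform μ) (hm : 2 ≤ m) (g : FreeGroup (Fin m)) {f : Boundary m → ℝ≥0∞}
    (hf : Measurable f) :
    ∫⁻ ω, f (boundaryAction m g ω) ∂μ = ∫⁻ ω, weight g ω * f ω ∂μ := by
  induction g using freeGroup_induction generalizing f with
  | one => simp [weight_one]
  | letter x =>
    simp_rw [boundaryAction_ofLetter]
    rw [← lintegral_map hf (measurable_letterAct x), hμ.map_letterAct hm x,
      lintegral_withDensity_eq_lintegral_mul _ (measurable_weight _) hf]
    rfl
  | mul g₁ g₂ h₁ h₂ =>
    simp_rw [map_mul, Equiv.Perm.mul_apply]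
    rw [h₂ (f := fun ω => f (boundaryAction m g₁ ω)) (hf.comp (measurable_boundaryAction g₁))]
    have := h₁ (f := fun ω => weight g₂ (boundaryAction m g₁⁻¹ ω) * f ω)
      (((measurable_weight g₂).comp (measurable_boundaryAction g₁⁻¹)).mul hf)
    simp only [boundaryAction_inv_apply_self] at this
    rw [this]
    refine lintegral_congr fun ω => ?_
    rw [weight_mul hm, mul_assoc]

theorem IsUniform.quasiMeasurePreserving_boundaryAction {μ : Measure (Boundary m)}
    [IsProbabilityMeasure μ] (hμ : IsUniform μ) (hm : 2 ≤ m) (g : FreeGroup (Fin m)) :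
    Measure.QuasiMeasurePreserving (boundaryAction m g) μ μ := by
  refine ⟨measurable_boundaryAction g, Measure.AbsolutelyContinuous.mk fun s hs h0 => ?_⟩
  rw [← lintegral_indicator_one hs, lintegral_map (measurable_one.indicator hs)
    (measurable_boundaryAction g), hμ.lintegral_boundaryAction hm g (measurable_one.indicator hs)]
  refine (lintegral_congr_ae ?_).trans lintegral_zero
  filter_upwards [measure_eq_zero_iff_ae_notMem.1 h0] with ω hω
  simp [hω]

/-- The boundary points whose Busemann function is nonnegative on `H`. -/
def minRegion (H : Subgroup (FreeGroup (Fin m))) : Set (Boundary m) :=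
  {ω | ∀ h : H, 0 ≤ busemann (h : FreeGroup (Fin m)) ω}

theorem measurableSet_minRegion (H : Subgroup (FreeGroup (Fin m))) :
    MeasurableSet (minRegion H) := by
  rw [minRegion, Set.ofPred_forall]
  exact MeasurableSet.iInter fun h => measurableSet_le measurable_const (measurable_busemann _)

theorem finite_setOf_wlen_eq (n : ℕ) : {g : FreeGroup (Fin m) | wlen g = n}.Finite :=
  (List.finite_length_eq (Letter m) n).preimage FreeGroup.toWord_injective.injOn

/-- The nontrivial elements that are the first half of an element of `H` and whose cylinder
meets `minRegion H`. -/
def halfWords (H : Subgroup (FreeGroup (Fin m))) : Set (FreeGroup (Fin m)) :=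
  {g | g ≠ 1 ∧ (cylinder g ∩ minRegion H).Nonempty ∧
    ∃ h : H, wlen (h : FreeGroup (Fin m)) = 2 * wlen g ∧ initial h.1 (wlen g) = g}

theorem IsUniform.tsum_halfWords_ne_top {μ : Measure (Boundary m)} [IsProbabilityMeasure μ]
    (hμ : IsUniform μ) (hm : 2 ≤ m) (H : Subgroup (FreeGroup (Fin m))) :
    ∑' g : halfWords H, μ (cylinder g.1) ≠ ⊤ := by
  choose hne hmeet h hlen hinit using fun g : halfWords H => g.2
  have hpos (g : halfWords H) : wlen g.1 ≠ 0 := wlen_ne_zero_iff.2 (hne g)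
  have hle (g : halfWords H) : wlen g.1 + 1 ≤ wlen (h g).1 := by
    have := hpos g
    rw [hlen g]
    omega
  set g' : halfWords H → FreeGroup (Fin m) := fun g => initial (h g).1 (wlen g.1 + 1)
  have hg' (g : halfWords H) : wlen (g' g) = wlen g.1 + 1 := wlen_initial (hle g)
  have hmem (g : halfWords H) {ω : Boundary m} (hω : ω ∈ cylinder (g' g)) : ω ∈ cylinder g.1 := by
    rw [← hinit g, mem_cylinder_initial_iff (by have := hle g; omega)]
    rw [mem_cylinder_initial_iff (hle g)] at hω
    omega
  have hout (g : halfWords H) {ω : Boundary m} (hω : ω ∈ cylinder (g' g)) : ω ∉ minRegion H := by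
    intro hD
    have h1 := hD (h g)
    rw [mem_cylinder_initial_iff (hle g)] at hω
    rw [busemann, hlen g] at h1
    push_cast at h1
    omega
  have hlt {g₁ g₂ : halfWords H} (h12 : wlen g₁.1 < wlen g₂.1) {ω : Boundary m}
      (h1 : ω ∈ cylinder (g' g₁)) (h2 : ω ∈ cylinder (g' g₂)) : False := by
    obtain ⟨η, hη, hD⟩ := hmeet g₂
    exact hout g₁ (cylinder_subset_of_mem (by rw [hg' g₁]; omega) h1 (hmem g₂ h2) hη) hD
  have hdisj : Pairwise (Function.onFun Disjoint fun g : halfWords H => cylinder (g' g)) := by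
    intro g₁ g₂ hne
    refine Set.disjoint_left.2 fun ω h1 h2 => ?_
    rcases lt_trichotomy (wlen g₁.1) (wlen g₂.1) with h12 | h12 | h12
    · exact hlt h12 h1 h2
    · refine hne (Subtype.ext ?_)
      rw [eq_trunc_of_mem_cylinder (hmem g₁ h1), eq_trunc_of_mem_cylinder (hmem g₂ h2), h12]
    · exact hlt h12 h2 h1
  simp_rw [fun g : halfWords H => hμ.measure_cylinder_succ hm (hne g) (hg' g)]
  rw [ENNReal.tsum_mul_left]
  refine ENNReal.mul_ne_top (ENNReal.natCast_ne_top _) (ne_top_of_le_ne_top ?_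
    (tsum_meas_le_meas_iUnion_of_disjoint μ (fun g => measurableSet_cylinder (g' g)) hdisj))
  exact measure_ne_top μ _

/-- Almost every point of `minRegion H` has finitely many zeros of its Busemann function
on `H`. -/
theorem IsUniform.ae_finite_zeros {μ : Measure (Boundary m)} [IsProbabilityMeasure μ]
    (hμ : IsUniform μ) (hm : 2 ≤ m) (H : Subgroup (FreeGroup (Fin m))) :
    ∀ᵐ ω ∂μ, ω ∈ minRegion H → {h : H | busemann (h : FreeGroup (Fin m)) ω = 0}.Finite := by
  filter_upwards [ae_finite_setOfPred_mem (hμ.tsum_halfWords_ne_top hm H)] with ω hfin hD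
  have : ((⋃ g ∈ {g : halfWords H | ω ∈ cylinder g.1},
      {h : FreeGroup (Fin m) | wlen h = 2 * wlen g.1}) ∪ {1}).Finite :=
    (hfin.biUnion fun g _ => finite_setOf_wlen_eq _).union (Set.finite_singleton 1)
  refine (this.preimage (f := fun h : H => h.1) Subtype.val_injective.injOn).subset fun h h0 => ?_
  have hlen : wlen h.1 = 2 * gromov h.1 ω := by
    rw [Set.mem_ofPred_eq, busemann] at h0
    omega
  by_cases hk : gromov h.1 ω = 0
  · right
    by_contra hne
    exact wlen_ne_zero_iff.2 hne (by rw [hlen, hk])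
  · left
    have hle := gromov_le_wlen h.1 ω
    have hmem : ω ∈ cylinder (initial h.1 (gromov h.1 ω)) :=
      (mem_cylinder_initial_iff hle ω).2 le_rfl
    have hwlen := wlen_initial hle
    have hg : initial h.1 (gromov h.1 ω) ∈ halfWords H :=
      ⟨wlen_ne_zero_iff.1 (by rwa [hwlen]), ⟨ω, hmem, hD⟩, h, by rwa [hwlen], by rw [hwlen]⟩
    simp only [Set.mem_iUnion, Set.mem_ofPred_eq, exists_prop]
    exact ⟨⟨_, hg⟩, hmem, by rwa [hwlen]⟩

/-- The number of zeros on `H` of the Busemann function. -/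
def zeroCount (H : Subgroup (FreeGroup (Fin m))) (ω : Boundary m) : ℝ≥0∞ :=
  ∑' h : H, if busemann (h : FreeGroup (Fin m)) ω = 0 then 1 else 0

theorem measurable_zeroCount (H : Subgroup (FreeGroup (Fin m))) : Measurable (zeroCount H) :=
  Measurable.tsum fun _ => Measurable.ite
    (measurableSet_eq_fun (measurable_busemann _) measurable_const) measurable_const
    measurable_const

theorem zeroCount_ne_top {H : Subgroup (FreeGroup (Fin m))} {ω : Boundary m}
    (h : {h : H | busemann (h : FreeGroup (Fin m)) ω = 0}.Finite) : zeroCount H ω ≠ ⊤ := by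
  rw [zeroCount, tsum_eq_sum (s := h.toFinset) fun g hg => if_neg (by simpa using hg)]
  exact ENNReal.sum_ne_top.2 fun g _ => by split_ifs <;> simp

/-- If two points of an `H`-orbit lie in `minRegion H`, the element relating them is a zero
of the Busemann function. -/
theorem busemann_eq_zero_of_mem_minRegion {H : Subgroup (FreeGroup (Fin m))} {ω : Boundary m}
    {h₀ h : H} (h₀mem : boundaryAction m h₀.1 ω ∈ minRegion H)
    (hmem : boundaryAction m h.1 ω ∈ minRegion H) :
    busemann (h₀ * h⁻¹ : H).1 (boundaryAction m h₀.1 ω) = 0 := by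
  have h1 := h₀mem (h₀ * h⁻¹)
  have h2 := hmem (h * h₀⁻¹)
  rw [busemann_boundaryAction] at h1 h2 ⊢
  simp only [Subgroup.coe_mul, Subgroup.coe_inv, inv_mul_cancel_left] at h1 h2 ⊢
  omega

theorem IsUniform.lintegral_tsum_weight_mul_le {μ : Measure (Boundary m)}
    [IsProbabilityMeasure μ] (hμ : IsUniform μ) (hm : 2 ≤ m) (H : Subgroup (FreeGroup (Fin m)))
    {f : Boundary m → ℝ≥0∞} (hf : Measurable f) {c : ℝ≥0∞}
    (hc : ∀ ω, ∑' h : H, f (boundaryAction m h.1 ω) ≤ c) :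
    ∫⁻ ω, ∑' h : H, weight h.1 ω * f ω ∂μ ≤ c := by
  have hw (h : H) : AEMeasurable (fun ω => weight h.1 ω * f ω) μ :=
    ((measurable_weight h.1).mul hf).aemeasurable
  have hact (h : H) : AEMeasurable (fun ω => f (boundaryAction m h.1 ω)) μ :=
    (hf.comp (measurable_boundaryAction h.1)).aemeasurable
  calc ∫⁻ ω, ∑' h : H, weight h.1 ω * f ω ∂μ
      = ∑' h : H, ∫⁻ ω, weight h.1 ω * f ω ∂μ := lintegral_tsum hw
    _ = ∑' h : H, ∫⁻ ω, f (boundaryAction m h.1 ω) ∂μ :=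
        tsum_congr fun h => (hμ.lintegral_boundaryAction hm h.1 hf).symm
    _ = ∫⁻ ω, ∑' h : H, f (boundaryAction m h.1 ω) ∂μ := (lintegral_tsum hact).symm
    _ ≤ ∫⁻ _, c ∂μ := lintegral_mono hc
    _ = c := by simp

theorem IsUniform.ae_tsum_weight_ne_top_of_zeroCount_le {μ : Measure (Boundary m)}
    [IsProbabilityMeasure μ] (hμ : IsUniform μ) (hm : 2 ≤ m) (H : Subgroup (FreeGroup (Fin m)))
    (K : ℕ) :
    ∀ᵐ ω ∂μ, ω ∈ minRegion H → zeroCount H ω ≤ K → ∑' h : H, weight h.1 ω ≠ ⊤ := by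
  set D : Set (Boundary m) := minRegion H ∩ {ω | zeroCount H ω ≤ K}
  have hD : MeasurableSet D :=
    (measurableSet_minRegion H).inter (measurableSet_le (measurable_zeroCount H) measurable_const)
  set χ : Boundary m → ℝ≥0∞ := D.indicator 1
  have hχ : Measurable χ := measurable_one.indicator hD
  have hw (h : H) : Measurable fun ω => weight h.1 ω * χ ω := (measurable_weight h.1).mul hχ
  have hbound (ω : Boundary m) : ∑' h : H, χ (boundaryAction m h.1 ω) ≤ K := by
    by_cases hex : ∃ h₀ : H, boundaryAction m h₀.1 ω ∈ D
    · obtain ⟨h₀, hh₀⟩ := hex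
      refine le_trans ?_ hh₀.2
      refine le_trans (ENNReal.tsum_le_tsum fun h => ?_)
        (((Equiv.inv H).trans (Equiv.mulLeft h₀)).tsum_eq fun h : H =>
          if busemann h.1 (boundaryAction m h₀.1 ω) = 0 then (1 : ℝ≥0∞) else 0).le
      by_cases hh : boundaryAction m h.1 ω ∈ D
      · have := busemann_eq_zero_of_mem_minRegion hh₀.1 hh.1
        simp only [Equiv.trans_apply, Equiv.inv_apply, Equiv.coe_mulLeft]
        rw [if_pos this]
        exact Set.indicator_le_self' (by simp) _
      · rw [show χ (boundaryAction m h.1 ω) = 0 from Set.indicator_of_notMem hh 1]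
        exact zero_le
    · push Not at hex
      simp [χ, hex]
  have hint : ∫⁻ ω, ∑' h : H, weight h.1 ω * χ ω ∂μ ≠ ⊤ := 
    ne_top_of_le_ne_top (ENNReal.natCast_ne_top K)
      (hμ.lintegral_tsum_weight_mul_le hm H hχ hbound)
  filter_upwards [ae_lt_top (Measurable.tsum hw) hint] with ω hω h1 h2
  have : ω ∈ D := ⟨h1, h2⟩
  simpa [χ, this] using hω.ne

theorem IsUniform.ae_tsum_weight_ne_top {μ : Measure (Boundary m)} [IsProbabilityMeasure μ]
    (hμ : IsUniform μ) (hm : 2 ≤ m) (H : Subgroup (FreeGroup (Fin m))) :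
    ∀ᵐ ω ∂μ, ω ∈ minRegion H → ∑' h : H, weight h.1 ω ≠ ⊤ := by
  filter_upwards [hμ.ae_finite_zeros hm H,
    ae_all_iff.2 (hμ.ae_tsum_weight_ne_top_of_zeroCount_le hm H)] with ω hfin hsum hD
  obtain ⟨K, hK⟩ := ENNReal.exists_nat_gt (zeroCount_ne_top (hfin hD))
  exact hsum K hD hK.le

theorem tsum_weight_boundaryAction_eq_top (hm : 2 ≤ m) {H : Subgroup (FreeGroup (Fin m))}
    {ω : Boundary m} (hω : ∑' h : H, weight h.1 ω = ⊤) (h₀ : H) :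
    ∑' h : H, weight h.1 (boundaryAction m h₀.1 ω) = ⊤ := by
  rw [← (Equiv.mulLeft h₀⁻¹).tsum_eq] at hω
  simp only [Equiv.coe_mulLeft, Subgroup.coe_mul, Subgroup.coe_inv, weight_mul hm, inv_inv] at hω
  rw [ENNReal.tsum_mul_left] at hω
  exact (ENNReal.mul_eq_top.1 hω).elim (·.2) fun h => absurd h.1 (weight_ne_top _ _ hm)

/-- If the Busemann function is bounded below on `H`, some translate lies in `minRegion H`. -/
theorem exists_boundaryAction_mem_minRegion {H : Subgroup (FreeGroup (Fin m))} {ω : Boundary m}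
    {N : ℤ} (hN : {g : FreeGroup (Fin m) | g ∈ H ∧ busemann g ω ≤ N}.Finite) :
    ∃ h : H, boundaryAction m h.1 ω ∈ minRegion H := by
  obtain ⟨B, hB⟩ := (hN.image fun g => busemann g ω).bddBelow
  obtain ⟨_, ⟨h, rfl⟩, hmin⟩ := Int.exists_least_of_bdd
    (P := fun z => ∃ h : H, busemann h.1 ω = z) ⟨min B N, by
      rintro _ ⟨h, rfl⟩
      rcases le_total (busemann h.1 ω) N with hle | hle
      · exact (min_le_left _ _).trans (hB ⟨h.1, ⟨h.2, hle⟩, rfl⟩)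
      · exact (min_le_right _ _).trans hle⟩ ⟨_, 1, rfl⟩
  refine ⟨h⁻¹, fun h' => ?_⟩
  have := hmin _ ⟨h * h', rfl⟩
  rw [busemann_boundaryAction]
  simpa using this

/-- **Horospheric limit sets.** `Λ^horS ⊆ Λ^horB ⊆ Σ`, and `μ(Σ \ Λ^horS) = 0`; so the
small and big horospheric limit sets and `Σ` all coincide up to `μ`-null sets. -/
theorem horospheric_limit_sets_coincide_mod_zero (m : ℕ) (hm : 2 ≤ m)
    (μ : Measure (Boundary m)) [IsProbabilityMeasure μ]
    (hμ : ∀ g : FreeGroup (Fin m), g ≠ 1 →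
      μ (cylinder g) = ((2 * m * (2 * m - 1) ^ (wlen g - 1) : ℕ) : ℝ≥0∞)⁻¹)
    (H : Subgroup (FreeGroup (Fin m)))
    (LhorS LhorB SigH : Set (Boundary m))
    (hS : LhorS = {ω : Boundary m | ∀ N : ℤ,
      {g : FreeGroup (Fin m) | g ∈ H ∧ busemann g ω ≤ N}.Infinite})
    (hB : LhorB = {ω : Boundary m | ∃ N : ℤ,
      {g : FreeGroup (Fin m) | g ∈ H ∧ busemann g ω ≤ N}.Infinite})
    (hSig : SigH = {ω : Boundary m |
      ∑' h : H, ((2 * m - 1 : ℕ) : ℝ≥0∞) ^ (-(busemann (h : FreeGroup (Fin m)) ω)) = ⊤}) :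
    LhorS ⊆ LhorB ∧ LhorB ⊆ SigH ∧ μ (SigH \ LhorS) = 0 := by
  have hμ' : IsUniform μ := hμ
  subst hS hB hSig
  refine ⟨fun ω hω => ⟨0, hω 0⟩, ?_, ?_⟩
  · rintro ω ⟨N, hN⟩
    by_contra hne
    have hq : (1 : ℝ≥0∞) ≤ ((2 * m - 1 : ℕ) : ℝ≥0∞) := by
      rw [Nat.one_le_cast]
      omega
    have hfin := ENNReal.finite_const_le_of_tsum_ne_top hne
      (ε := ((2 * m - 1 : ℕ) : ℝ≥0∞) ^ (-N))
      (ENNReal.zpow_pos (zero_lt_one.trans_le hq).ne' (ENNReal.natCast_ne_top _) _).ne'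
    refine hN ((hfin.image Subtype.val).subset ?_)
    rintro g ⟨hg, hle⟩
    exact ⟨⟨g, hg⟩, ENNReal.zpow_le_of_le hq (neg_le_neg hle), rfl⟩
  · have hnull : ∀ᵐ ω ∂μ, ∀ h : H, boundaryAction m h.1 ω ∈ minRegion H →
        ∑' h' : H, weight h'.1 (boundaryAction m h.1 ω) ≠ ⊤ :=
      ae_all_iff.2 fun h => (hμ'.quasiMeasurePreserving_boundaryAction hm h.1).ae
        (hμ'.ae_tsum_weight_ne_top hm H)
    refine measure_eq_zero_iff_ae_notMem.2 ?_
    filter_upwards [hnull] with ω hω ⟨hSig, hS⟩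
    simp only [Set.mem_ofPred_eq, not_forall, Set.not_infinite] at hS
    obtain ⟨N, hN⟩ := hS
    obtain ⟨h, hh⟩ := exists_boundaryAction_mem_minRegion hN
    exact hω h hh (tsum_weight_boundaryAction_eq_top hm hSig h)
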